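/- arXiv:1812.10326 — 4 statements merged into one kernel-verified Lean document; each statement's English description precedes it below -/
import Mathlib

section
/- Let (Ch,≽) be a market with contracts in which students have strict preferences monotone in contract terms and contracts are observable substitutes for monotone preferences under every college's choice function. If Y^1 ⊆ Y^2 ⊆ ... ⊆ Y^T ⊆ X are the cumulative sets of contracts proposed up to each round t of the student-proposing deferred acceptance algorithm in (Ch,≽), then for each college c the sets Y^1_c, ..., Y^T_c are observable under Ch_c. -/
open scoped Classical

namespace MWC

variable {C S T : Type*} [DecidableEq C] [DecidableEq S] [DecidableEq T] [LinearOrder T]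

/-! Contracts are triples `(college, student, term)`.  For `x : C × S × T`,
`x.1` is the college, `x.2.1` the student and `x.2.2` the contract term.
The linear order on `T` plays the role of `▷`: higher terms are better for students. -/

variable (X : Finset (C × S × T))

/-- The contracts in `X` naming college `c` (the set `X_c`). -/
def Xc (c : C) : Finset (C × S × T) := X.filter fun x => x.1 = c

/-- A set of contracts containing at most one contract per student. -/
def IsAlloc (Y : Finset (C × S × T)) : Prop :=
  ∀ x ∈ Y, ∀ y ∈ Y, x.2.1 = y.2.1 → x = y

/-- `Ch` is a valid choice function for college `c`: from each subset of `X_c` it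
chooses a subset with at most one contract per student, and it satisfies the
irrelevance of rejected contracts (IRC). -/
def IsChoice (c : C) (Ch : Finset (C × S × T) → Finset (C × S × T)) : Prop :=
  (∀ Y, Y ⊆ Xc X c → Ch Y ⊆ Y) ∧
  (∀ Y, Y ⊆ Xc X c → IsAlloc (Ch Y)) ∧
  (∀ Y, Y ⊆ Xc X c → ∀ x ∈ Xc X c, x ∉ Y → x ∉ Ch (insert x Y) → Ch Y = Ch (insert x Y))

/-- The rejection function `R_c(Y) = Y \ Ch_c(Y)`. -/
def Rej (Ch : Finset (C × S × T) → Finset (C × S × T)) (Y : Finset (C × S × T)) :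
    Finset (C × S × T) := Y \ Ch Y

/-- Contracts are substitutes under `Ch` (for college `c`). -/
def Substitutes (c : C) (Ch : Finset (C × S × T) → Finset (C × S × T)) : Prop :=
  ∀ Y, Y ⊆ Xc X c → ∀ x ∈ Xc X c, ∀ z ∈ Xc X c, x ∉ Y → z ∉ Y →
    x ∈ Ch (insert z (insert x Y)) → x ∈ Ch (insert x Y)

/-- The law of aggregate demand for `Ch` (college `c`). -/
def LAD (c : C) (Ch : Finset (C × S × T) → Finset (C × S × T)) : Prop :=
  ∀ Z Y, Z ⊆ Y → Y ⊆ Xc X c → (Ch Z).card ≤ (Ch Y).card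

/-- `Y^min`: the contracts of `Y` that give each involved student his
`▷`-worst contract among his contracts in `Y`. -/
def Ymin (Y : Finset (C × S × T)) : Finset (C × S × T) :=
  Y.filter fun y => ∀ y' ∈ Y, y'.2.1 = y.2.1 → ¬ y'.2.2 < y.2.2

/-- `Ch` is monotone in contract terms: it always chooses from `Y^min`. -/
def MonotoneCh (c : C) (Ch : Finset (C × S × T) → Finset (C × S × T)) : Prop :=
  ∀ Y, Y ⊆ Xc X c → Ch Y ⊆ Ymin Y

/-- `us` represents a strict preference of student `s` over his contracts in `X`
together with the outside option (utility `0`), monotone in contract terms: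
a higher contract term is always strictly better. -/
def IsPref (s : S) (us : C × S × T → ℤ) : Prop :=
  (∀ x ∈ X, x.2.1 = s → us x ≠ 0) ∧
  (∀ x ∈ X, ∀ y ∈ X, x.2.1 = s → y.2.1 = s → x ≠ y → us x ≠ us y) ∧
  (∀ x ∈ X, ∀ y ∈ X, x.2.1 = s → y.2.1 = s → y.2.2 < x.2.2 → us y < us x)

/-- The utility student `s` derives from allocation `Y` (`0` = outside option). -/
def util (us : C × S × T → ℤ) (s : S) (Y : Finset (C × S × T)) : ℤ :=
  ∑ x ∈ Y.filter (fun x => x.2.1 = s), us x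

/-- Individual rationality of allocation `Y` in the market `(Ch, u)`. -/
def IndivRat (Ch : C → Finset (C × S × T) → Finset (C × S × T))
    (u : S → C × S × T → ℤ) (Y : Finset (C × S × T)) : Prop :=
  (∀ c, Y.filter (fun x => x.1 = c) = Ch c (Y.filter fun x => x.1 = c)) ∧
  ∀ y ∈ Y, 0 < u y.2.1 y

/-- College `c` together with allocation `Z` blocks allocation `Y`. -/
def Blocks (Ch : C → Finset (C × S × T) → Finset (C × S × T))
    (u : S → C × S × T → ℤ) (c : C) (Z Y : Finset (C × S × T)) : Prop :=
  Z ⊆ X ∧ IsAlloc Z ∧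
  Z.filter (fun x => x.1 = c) ≠ Y.filter (fun x => x.1 = c) ∧
  Z.filter (fun x => x.1 = c) = Ch c ((Y ∪ Z).filter fun x => x.1 = c) ∧
  ∀ z ∈ Z.filter (fun x => x.1 = c), util (u z.2.1) z.2.1 Y ≤ u z.2.1 z

/-- Stability of allocation `Y` in the market `(Ch, u)`. -/
def Stable (Ch : C → Finset (C × S × T) → Finset (C × S × T))
    (u : S → C × S × T → ℤ) (Y : Finset (C × S × T)) : Prop :=
  Y ⊆ X ∧ IsAlloc Y ∧ IndivRat Ch u Y ∧ ¬ ∃ c Z, Blocks X Ch u c Z Y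

/-- The contracts proposed when `D` is the set of contracts rejected so far:
every student proposes his most preferred acceptable not-yet-rejected contract. -/
def proposals (u : S → C × S × T → ℤ) (D : Finset (C × S × T)) : Finset (C × S × T) :=
  (X \ D).filter fun x =>
    0 < u x.2.1 x ∧ ∀ y ∈ X \ D, y.2.1 = x.2.1 → u x.2.1 y ≤ u x.2.1 x

/-- The contracts tentatively held by the colleges among the proposals `P`:
each college `c` keeps its choice from the contracts proposed to it. -/
def held (Ch : C → Finset (C × S × T) → Finset (C × S × T))
    (P : Finset (C × S × T)) : Finset (C × S × T) :=
  P.filter fun x => x ∈ Ch x.1 (P.filter fun y => y.1 = x.1)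

/-- One round of the student-proposing deferred acceptance algorithm, acting on the
cumulative set of rejected contracts. -/
def step (Ch : C → Finset (C × S × T) → Finset (C × S × T))
    (u : S → C × S × T → ℤ) (D : Finset (C × S × T)) : Finset (C × S × T) :=
  D ∪ (proposals X u D \ held Ch (proposals X u D))

/-- The outcome `DA(Ch, u)` of the student-proposing deferred acceptance algorithm
(the algorithm reaches a fixed point after at most `|X| + 1` rounds). -/
def DA (Ch : C → Finset (C × S × T) → Finset (C × S × T))
    (u : S → C × S × T → ℤ) : Finset (C × S × T) :=
  held Ch (proposals X u ((step X Ch u)^[X.card + 1] ∅))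

/-- The cumulative set of contracts proposed up to round `t` of the deferred
acceptance algorithm. -/
def cumProposed (Ch : C → Finset (C × S × T) → Finset (C × S × T))
    (u : S → C × S × T → ℤ) (t : ℕ) : Finset (C × S × T) :=
  (Finset.range (t + 1)).biUnion fun r => proposals X u ((step X Ch u)^[r] ∅)

/-- Two choice profiles are deferred-acceptance-equivalent if the DA algorithm
produces the same outcome under both, for every profile of strict preferences
monotone in contract terms. -/
def DAeq (Ch Ch' : C → Finset (C × S × T) → Finset (C × S × T)) : Prop :=
  ∀ u : S → C × S × T → ℤ, (∀ s, IsPref X s (u s)) → DA X Ch u = DA X Ch' u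

/-- `Ch` is DA-stable: the DA outcome is stable for every profile of strict
preferences monotone in contract terms. -/
def DAStable (Ch : C → Finset (C × S × T) → Finset (C × S × T)) : Prop :=
  ∀ u : S → C × S × T → ℤ, (∀ s, IsPref X s (u s)) → Stable X Ch u (DA X Ch u)

/-- Mechanism `M` is `Ch`-stable. -/
def StableMech (Ch : C → Finset (C × S × T) → Finset (C × S × T))
    (M : (S → C × S × T → ℤ) → Finset (C × S × T)) : Prop :=
  ∀ u : S → C × S × T → ℤ, (∀ s, IsPref X s (u s)) → Stable X Ch u (M u)

/-- Strategy-proofness of a mechanism on the domain of strict preferences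
monotone in contract terms. -/
def SP (M : (S → C × S × T → ℤ) → Finset (C × S × T)) : Prop :=
  ∀ u u' : S → C × S × T → ℤ, (∀ s, IsPref X s (u s)) → (∀ s, IsPref X s (u' s)) →
    ∀ s : S, (∀ s', s' ≠ s → u' s' = u s') →
      util (u s) s (M u') ≤ util (u s) s (M u)

/-- Group-strategy-proofness of a mechanism on the domain of strict preferences
monotone in contract terms. -/
def GSP (M : (S → C × S × T → ℤ) → Finset (C × S × T)) : Prop :=
  ∀ u u' : S → C × S × T → ℤ, (∀ s, IsPref X s (u s)) → (∀ s, IsPref X s (u' s)) →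
    ∀ S' : Set S, S'.Nonempty → (∀ s, s ∉ S' → u' s = u s) →
      ∃ s' ∈ S', util (u s') s' (M u') ≤ util (u s') s' (M u)

/-- The sequence `L` consists of contracts in `X_c`. -/
def SeqIn (c : C) (L : List (C × S × T)) : Prop := ∀ x ∈ L, x ∈ Xc X c

/-- The sequence `L` is generated from monotone preferences: every contract (of the
relevant college) with the same student and a strictly higher term than the `t`-th
element appears among the first `t` elements. -/
def GenMono (c : C) (L : List (C × S × T)) : Prop :=
  ∀ (t : ℕ) (ht : t < L.length), ∀ x ∈ Xc X c, x.2.1 = (L.get ⟨t, ht⟩).2.1 →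
    (L.get ⟨t, ht⟩).2.2 < x.2.2 → x ∈ L.take t

/-- The sequence `L` is observable under `Ch`: the student of each next contract is
not among the students currently chosen by `Ch`. -/
def ObsSeq (Ch : Finset (C × S × T) → Finset (C × S × T)) (L : List (C × S × T)) : Prop :=
  ∀ (t : ℕ) (ht : t < L.length), 0 < t →
    (L.get ⟨t, ht⟩).2.1 ∉ (Ch (L.take t).toFinset).image fun y => y.2.1

/-- Observable substitutability for monotone preferences. -/
def ObsSub (c : C) (Ch : Finset (C × S × T) → Finset (C × S × T)) : Prop :=
  ∀ L : List (C × S × T), SeqIn X c L → GenMono X c L → ObsSeq Ch L →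
    ∀ t : ℕ, t + 1 ≤ L.length →
      Rej Ch (L.take t).toFinset ⊆ Rej Ch (L.take (t + 1)).toFinset

/-- The observable law of aggregate demand for monotone preferences. -/
def ObsLAD (c : C) (Ch : Finset (C × S × T) → Finset (C × S × T)) : Prop :=
  ∀ L : List (C × S × T), SeqIn X c L → GenMono X c L → ObsSeq Ch L →
    ∀ t : ℕ, t + 1 ≤ L.length →
      (Ch (L.take t).toFinset).card ≤ (Ch (L.take (t + 1)).toFinset).card

/-- `Y` is an observable set under `Ch`. -/
def ObsSet (c : C) (Ch : Finset (C × S × T) → Finset (C × S × T))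
    (Y : Finset (C × S × T)) : Prop :=
  ∃ L : List (C × S × T), L.Nodup ∧ L.toFinset = Y ∧ SeqIn X c L ∧
    GenMono X c L ∧ ObsSeq Ch L

/-- `Ytil` is a maximal observable subset of `Y` under `Ch`. -/
def MaxObsSubset (c : C) (Ch : Finset (C × S × T) → Finset (C × S × T))
    (Y Ytil : Finset (C × S × T)) : Prop :=
  Ytil ⊆ Y ∧ ObsSet X c Ch Ytil ∧
    ∀ Y', ObsSet X c Ch Y' → Ytil ⊆ Y' → Y' ⊆ Y → Y' = Ytil

/-- `U(Y)`: the contracts in `X_c` that are at least as good for the involved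
student as some contract of his in `Y`. -/
def Uset (c : C) (Y : Finset (C × S × T)) : Finset (C × S × T) :=
  (Xc X c).filter fun x => ∃ y ∈ Y, x.2.1 = y.2.1 ∧ (y.2.2 < x.2.2 ∨ x = y)

/-- `Y^∨`: the (under observable substitutability unique) maximal observable subset
of `U(Y)` under `Ch`. -/
noncomputable def vee (c : C) (Ch : Finset (C × S × T) → Finset (C × S × T))
    (Y : Finset (C × S × T)) : Finset (C × S × T) :=
  if h : ∃ V, MaxObsSubset X c Ch (Uset X c Y) V then h.choose else ∅

/-- The virtual choice function
`Ch'_c(Y) = { x ∈ Y^min : x_S ∈ [Ch_c(Y^∨)]_S }`. -/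
noncomputable def virtualChoice (c : C) (Ch : Finset (C × S × T) → Finset (C × S × T))
    (Y : Finset (C × S × T)) : Finset (C × S × T) :=
  (Ymin Y).filter fun x => x.2.1 ∈ (Ch (vee X c Ch Y)).image fun y => y.2.1

/-- A duplicate-free observable sequence of college `c` generated from monotone preferences. -/
def GoodSeq (c : C) (Ch : Finset (C × S × T) → Finset (C × S × T))
    (L : List (C × S × T)) : Prop :=
  L.Nodup ∧ SeqIn X c L ∧ GenMono X c L ∧ ObsSeq Ch L

lemma goodSeq_snoc {X : Finset (C × S × T)} {c : C}
    {Ch : Finset (C × S × T) → Finset (C × S × T)} {L : List (C × S × T)}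
    (h : GoodSeq X c Ch L) {x : C × S × T} (hx : x ∈ Xc X c) (hxL : x ∉ L)
    (hb : ∀ y ∈ Xc X c, y.2.1 = x.2.1 → x.2.2 < y.2.2 → y ∈ L)
    (ho : ∀ y ∈ Ch L.toFinset, y.2.1 ≠ x.2.1) : GoodSeq X c Ch (L ++ [x]) := by
  obtain ⟨h1, h2, h3, h4⟩ := h
  refine ⟨?_, ?_, ?_, ?_⟩
  · rw [List.nodup_append]
    refine ⟨h1, by simp, ?_⟩
    intro a ha b hb' hab
    simp only [List.mem_singleton] at hb'
    exact hxL (hb' ▸ hab ▸ ha)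
  · intro y hy
    rw [List.mem_append, List.mem_singleton] at hy
    rcases hy with hy | rfl
    · exact h2 y hy
    · exact hx
  · intro t ht y hy
    rcases Nat.lt_or_ge t L.length with hlt | hge
    · have e : (L ++ [x]).get ⟨t, ht⟩ = L.get ⟨t, hlt⟩ := by
        simp [List.getElem_append_left hlt]
      rw [e, List.take_append_of_le_length hlt.le]
      exact h3 t hlt y hy
    · have : t = L.length := by simp at ht; omega
      subst this
      simpa using hb y hy
  · intro t ht h0
    rcases Nat.lt_or_ge t L.length with hlt | hge
    · have e : (L ++ [x]).get ⟨t, ht⟩ = L.get ⟨t, hlt⟩ := by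
        simp [List.getElem_append_left hlt]
      rw [e, List.take_append_of_le_length hlt.le]
      exact h4 t hlt h0
    · have : t = L.length := by simp at ht; omega
      subst this
      have e : (L ++ [x]).get ⟨L.length, ht⟩ = x := by simp
      rw [e, List.take_left, Finset.mem_image]
      rintro ⟨y, hy, hyx⟩
      exact ho y hy hyx

lemma goodSeq_extend {X : Finset (C × S × T)} {c : C}
    {Ch : Finset (C × S × T) → Finset (C × S × T)} (hCh : IsChoice X c Ch)
    (hobs : ObsSub X c Ch) {L : List (C × S × T)} (h : GoodSeq X c Ch L)
    (N : Finset (C × S × T)) :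
    (∀ x ∈ N, x ∈ Xc X c) → (∀ x ∈ N, x ∉ L) →
    (∀ x ∈ N, ∀ y ∈ N, x.2.1 = y.2.1 → x = y) →
    (∀ x ∈ N, ∀ y ∈ Xc X c, y.2.1 = x.2.1 → x.2.2 < y.2.2 → y ∈ L) →
    (∀ x ∈ N, ∀ y ∈ Ch L.toFinset, y.2.1 ≠ x.2.1) →
    ∃ L', GoodSeq X c Ch L' ∧ L'.toFinset = L.toFinset ∪ N ∧
      Rej Ch L.toFinset ⊆ Rej Ch L'.toFinset := by
  induction N using Finset.induction_on with
  | empty =>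
    intros
    exact ⟨L, h, by simp, Finset.Subset.refl _⟩
  | insert x N hxN ih =>
    intro hX hL hA hB hO
    obtain ⟨L', hg, he, hr⟩ := ih (fun z hz => hX z (Finset.mem_insert_of_mem hz))
      (fun z hz => hL z (Finset.mem_insert_of_mem hz))
      (fun z hz w hw => hA z (Finset.mem_insert_of_mem hz) w (Finset.mem_insert_of_mem hw))
      (fun z hz => hB z (Finset.mem_insert_of_mem hz))
      (fun z hz => hO z (Finset.mem_insert_of_mem hz))
    have hxi := Finset.mem_insert_self x N
    have hmem : ∀ z, z ∈ L' ↔ z ∈ L ∨ z ∈ N := by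
      intro z
      rw [← List.mem_toFinset, he, Finset.mem_union, List.mem_toFinset]
    have hsub : L'.toFinset ⊆ Xc X c := fun z hz => hg.2.1 z (List.mem_toFinset.1 hz)
    have hg' : GoodSeq X c Ch (L' ++ [x]) := by
      apply goodSeq_snoc hg (hX x hxi)
      · rw [hmem]
        rintro (h1 | h1)
        · exact hL x hxi h1
        · exact hxN h1
      · intro y hy h1 h2
        exact (hmem y).2 (Or.inl (hB x hxi y hy h1 h2))
      · intro y hy hyx
        have hyL' := List.mem_toFinset.1 (hCh.1 _ hsub hy)
        rcases (hmem y).1 hyL' with h1 | h1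
        · by_cases h2 : y ∈ Ch L.toFinset
          · exact hO x hxi y h2 hyx
          · have h3 : y ∈ Rej Ch L.toFinset :=
              Finset.mem_sdiff.2 ⟨List.mem_toFinset.2 h1, h2⟩
            exact (Finset.mem_sdiff.1 (hr h3)).2 hy
        · exact hxN (hA y (Finset.mem_insert_of_mem h1) x hxi hyx ▸ h1)
    refine ⟨L' ++ [x], hg', ?_, ?_⟩
    · ext z
      simp only [List.mem_toFinset, List.mem_append, hmem, List.mem_singleton,
        Finset.mem_union, Finset.mem_insert]
      tauto
    · have := hobs _ hg'.2.1 hg'.2.2.1 hg'.2.2.2 L'.length (by simp)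
      rw [List.take_left, List.take_of_length_le (by simp)] at this
      exact hr.trans this

lemma irc_subset {X : Finset (C × S × T)} {c : C}
    {Ch : Finset (C × S × T) → Finset (C × S × T)} (hCh : IsChoice X c Ch)
    (A : Finset (C × S × T)) (M : Finset (C × S × T)) :
    A ∪ M ⊆ Xc X c → Disjoint A M → Ch (A ∪ M) ⊆ A → Ch A = Ch (A ∪ M) := by
  induction M using Finset.induction_on with
  | empty => intros; simp
  | insert x M hxM ih =>
    intro h1 h2 h3
    rw [Finset.union_insert] at h1 h3 ⊢
    rw [Finset.disjoint_insert_right] at h2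
    have hs : A ∪ M ⊆ Xc X c := (Finset.subset_insert _ _).trans h1
    have e : Ch (A ∪ M) = Ch (insert x (A ∪ M)) :=
      hCh.2.2 _ hs x (h1 (Finset.mem_insert_self _ _))
        (by rw [Finset.mem_union]; tauto) (fun h => h2.1 (h3 h))
    rw [← e]
    exact ih hs h2.2 (by rw [e]; exact h3)

lemma mem_proposals {X : Finset (C × S × T)} {u : S → C × S × T → ℤ} {D : Finset (C × S × T)}
    {x : C × S × T} : x ∈ proposals X u D ↔ (x ∈ X ∧ x ∉ D) ∧ 0 < u x.2.1 x ∧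
      ∀ y, y ∈ X → y ∉ D → y.2.1 = x.2.1 → u x.2.1 y ≤ u x.2.1 x := by
  simp only [proposals, Finset.mem_filter, Finset.mem_sdiff, and_imp]

lemma proposals_unique {X : Finset (C × S × T)} {u : S → C × S × T → ℤ}
    (hu : ∀ s, IsPref X s (u s)) {D : Finset (C × S × T)}
    {x y : C × S × T} (hx : x ∈ proposals X u D) (hy : y ∈ proposals X u D)
    (h : x.2.1 = y.2.1) : x = y := by
  rw [mem_proposals] at hx hy
  by_contra hne
  have h1 := hx.2.2 y hy.1.1 hy.1.2 h.symm
  have h2 := hy.2.2 x hx.1.1 hx.1.2 h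
  rw [← h] at h2
  exact (hu x.2.1).2.1 x hx.1.1 y hy.1.1 rfl h.symm hne (le_antisymm h2 h1)

lemma proposals_mono {X : Finset (C × S × T)} {u : S → C × S × T → ℤ}
    {D D' : Finset (C × S × T)} (h : D ⊆ D') {x : C × S × T} (hx : x ∈ proposals X u D)
    (hx' : x ∉ D') : x ∈ proposals X u D' := by
  rw [mem_proposals] at hx ⊢
  exact ⟨⟨hx.1.1, hx'⟩, hx.2.1, fun y hy hyD => hx.2.2 y hy (fun h' => hyD (h h'))⟩

/-- Rejected set at the start of round `t`. -/
def rejAt (Ch : C → Finset (C × S × T) → Finset (C × S × T))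
    (u : S → C × S × T → ℤ) (t : ℕ) : Finset (C × S × T) := (step X Ch u)^[t] ∅

lemma rejAt_succ (Ch : C → Finset (C × S × T) → Finset (C × S × T))
    (u : S → C × S × T → ℤ) (t : ℕ) :
    rejAt X Ch u (t + 1) = step X Ch u (rejAt X Ch u t) := by
  simp only [rejAt, Function.iterate_succ_apply']

lemma rejAt_mono (Ch : C → Finset (C × S × T) → Finset (C × S × T))
    (u : S → C × S × T → ℤ) : Monotone (rejAt X Ch u) := by
  apply monotone_nat_of_le_succ
  intro t
  rw [rejAt_succ]
  exact Finset.subset_union_left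

/-- Contracts proposed to `c` strictly before round `t`. -/
def cumB (Ch : C → Finset (C × S × T) → Finset (C × S × T))
    (u : S → C × S × T → ℤ) (c : C) (t : ℕ) : Finset (C × S × T) :=
  ((Finset.range t).biUnion fun r => proposals X u (rejAt X Ch u r)).filter fun x => x.1 = c

lemma mem_cumB {X : Finset (C × S × T)} {Ch : C → Finset (C × S × T) → Finset (C × S × T)}
    {u : S → C × S × T → ℤ} {c : C} {t : ℕ} {x : C × S × T} : x ∈ cumB X Ch u c t ↔
      (∃ r < t, x ∈ proposals X u (rejAt X Ch u r)) ∧ x.1 = c := by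
  simp [cumB]

lemma mem_Xc {X : Finset (C × S × T)} {c : C} {x : C × S × T} :
    x ∈ Xc X c ↔ x ∈ X ∧ x.1 = c := by
  simp [Xc]

lemma main_inv (X : Finset (C × S × T)) (Ch : C → Finset (C × S × T) → Finset (C × S × T))
    (u : S → C × S × T → ℤ)
    (hCh : ∀ c, IsChoice X c (Ch c))
    (hobs : ∀ c, ObsSub X c (Ch c))
    (hu : ∀ s, IsPref X s (u s)) (c : C) (t : ℕ) :
    ∃ L, GoodSeq X c (Ch c) L ∧ L.toFinset = cumB X Ch u c t ∧
      ∀ x, (x ∈ rejAt X Ch u t ∧ x.1 = c) ↔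
        (x ∈ cumB X Ch u c t ∧ x ∉ Ch c (cumB X Ch u c t)) := by
  induction t with
  | zero =>
    refine ⟨[], ⟨by simp, by simp [SeqIn], by simp [GenMono], by simp [ObsSeq]⟩, by simp [cumB],
      by simp [rejAt, cumB]⟩
  | succ t ih =>
    obtain ⟨L, hL, he, hD⟩ := ih
    set Y := cumB X Ch u c t with hY
    set D := rejAt X Ch u t with hDdef
    set P := proposals X u D with hP
    have hLm : ∀ z, z ∈ L ↔ z ∈ Y := fun z => by rw [← he, List.mem_toFinset]
    have hYX : Y ⊆ Xc X c := fun z hz => hL.2.1 z ((hLm z).2 hz)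
    -- held contracts are proposed again
    have hheld : ∀ z ∈ Ch c Y, z ∈ P ∧ z.1 = c := by
      intro z hz
      have hzY := (hCh c).1 _ hYX hz
      obtain ⟨⟨r, hr, hzr⟩, hzc⟩ := mem_cumB.1 hzY
      refine ⟨proposals_mono (rejAt_mono X Ch u hr.le) hzr ?_, hzc⟩
      intro hzD
      exact ((hD z).1 ⟨hzD, hzc⟩).2 hz
    have hsucc : ∀ z, z ∈ cumB X Ch u c (t + 1) ↔ z ∈ Y ∨ (z ∈ P ∧ z.1 = c) := by
      intro z
      rw [hY, mem_cumB, mem_cumB]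
      constructor
      · rintro ⟨⟨r, hr, hz⟩, hc⟩
        rcases Nat.lt_succ_iff_lt_or_eq.1 hr with h | rfl
        · exact Or.inl ⟨⟨r, h, hz⟩, hc⟩
        · exact Or.inr ⟨hz, hc⟩
      · rintro (⟨⟨r, hr, hz⟩, hc⟩ | ⟨hz, hc⟩)
        · exact ⟨⟨r, by omega, hz⟩, hc⟩
        · exact ⟨⟨t, by omega, hz⟩, hc⟩
    have hPX : ∀ z ∈ P, z ∈ X := fun z hz => (mem_proposals.1 hz).1.1
    obtain ⟨L', hL', he', hr⟩ := goodSeq_extend (hCh c) (hobs c) hL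
      ((P.filter fun x => x.1 = c) \ Y)
      (by
        intro x hx
        rw [Finset.mem_sdiff, Finset.mem_filter] at hx
        exact mem_Xc.2 ⟨hPX x hx.1.1, hx.1.2⟩)
      (by
        intro x hx
        rw [Finset.mem_sdiff] at hx
        rw [hLm]; exact hx.2)
      (by
        intro x hx y hy hxy
        rw [Finset.mem_sdiff, Finset.mem_filter] at hx hy
        exact proposals_unique hu hx.1.1 hy.1.1 hxy)
      (by
        intro x hx y hy hs ht
        rw [Finset.mem_sdiff, Finset.mem_filter] at hx
        rw [mem_Xc] at hy
        have hxP := mem_proposals.1 hx.1.1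
        have hlt := (hu x.2.1).2.2 y hy.1 x hxP.1.1 hs rfl ht
        have hyD : y ∈ D := by
          by_contra hyD
          exact absurd (hxP.2.2 y hy.1 hyD hs) (not_le.2 hlt)
        exact (hLm y).2 ((hD y).1 ⟨hyD, hy.2⟩).1)
      (by
        intro x hx y hy hs
        rw [he] at hy
        rw [Finset.mem_sdiff, Finset.mem_filter] at hx
        have := proposals_unique hu (hheld y hy).1 hx.1.1 hs
        subst this
        exact hx.2 ((hCh c).1 _ hYX hy))
    have he2 : L'.toFinset = cumB X Ch u c (t + 1) := by
      ext z
      rw [he', hsucc, he]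
      simp only [Finset.mem_union, Finset.mem_sdiff, Finset.mem_filter]
      tauto
    rw [he, he2] at hr
    refine ⟨L', hL', he2, ?_⟩
    set Y' := cumB X Ch u c (t + 1) with hY'
    have hY'X : Y' ⊆ Xc X c := fun z hz => hL'.2.1 z (by rwa [← he2, List.mem_toFinset] at hz)
    have hrm : ∀ z, z ∈ Y → z ∉ Ch c Y → z ∉ Ch c Y' := fun z h1 h2 =>
      (Finset.mem_sdiff.1 (hr (Finset.mem_sdiff.2 ⟨h1, h2⟩))).2
    set Pc := P.filter (fun x => x.1 = c) with hPc
    have hPY : Pc ⊆ Y' := by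
      intro z hz
      rw [hPc, Finset.mem_filter] at hz
      exact (hsucc z).2 (Or.inr hz)
    have hchP : Ch c Y' ⊆ Pc := by
      intro z hz
      rw [hPc, Finset.mem_filter]
      rcases (hsucc z).1 ((hCh c).1 _ hY'X hz) with h | h
      · by_cases h' : z ∈ Ch c Y
        · exact hheld z h'
        · exact absurd hz (hrm z h h')
      · exact h
    have hU : Pc ∪ (Y' \ Pc) = Y' := Finset.union_sdiff_of_subset hPY
    have hirc : Ch c Pc = Ch c Y' := by
      have := irc_subset (hCh c) Pc (Y' \ Pc) (by rw [hU]; exact hY'X)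
        Finset.disjoint_sdiff (by rw [hU]; exact hchP)
      rwa [hU] at this
    intro x
    have hstep : (x ∈ rejAt X Ch u (t + 1) ∧ x.1 = c) ↔
        ((x ∈ D ∧ x.1 = c) ∨ (x ∈ P ∧ x.1 = c ∧ x ∉ Ch c Y')) := by
      rw [rejAt_succ, step, ← hDdef, ← hP, Finset.mem_union, Finset.mem_sdiff, held,
        Finset.mem_filter]
      constructor
      · rintro ⟨h | ⟨h1, h2⟩, rfl⟩
        · exact Or.inl ⟨h, rfl⟩
        · rw [← hPc, hirc] at h2
          exact Or.inr ⟨h1, rfl, fun h => h2 ⟨h1, h⟩⟩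
      · rintro (⟨h, h'⟩ | ⟨h1, rfl, h2⟩)
        · exact ⟨Or.inl h, h'⟩
        · rw [← hPc, hirc]
          exact ⟨Or.inr ⟨h1, fun h => h2 h.2⟩, rfl⟩
    rw [hstep, hD, hsucc]
    constructor
    · rintro (⟨h1, h2⟩ | ⟨h1, h2, h3⟩)
      · exact ⟨Or.inl h1, hrm x h1 h2⟩
      · exact ⟨Or.inr ⟨h1, h2⟩, h3⟩
    · rintro ⟨h1 | h1, h2⟩
      · by_cases h3 : x ∈ Ch c Y
        · exact Or.inr ⟨(hheld x h3).1, (hheld x h3).2, h2⟩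
        · exact Or.inl ⟨h1, h3⟩
      · exact Or.inr ⟨h1.1, h1.2, h2⟩

/-- under observable substitutability, the cumulative sets of
contracts proposed to each college during the DA algorithm are observable. -/
theorem statement_7 [Fintype C] [Fintype S] [Fintype T]
    (X : Finset (C × S × T)) (Ch : C → Finset (C × S × T) → Finset (C × S × T))
    (u : S → C × S × T → ℤ)
    (hCh : ∀ c, IsChoice X c (Ch c))
    (hobs : ∀ c, ObsSub X c (Ch c))
    (hu : ∀ s, IsPref X s (u s)) :
    ∀ (c : C) (t : ℕ),
      ObsSet X c (Ch c) ((cumProposed X Ch u t).filter fun x => x.1 = c) := by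
  intro c t
  obtain ⟨L, hL, he, -⟩ := main_inv X Ch u hCh hobs hu c (t + 1)
  exact ⟨L, hL.1, he, hL.2.1, hL.2.2.1, hL.2.2.2⟩

end MWC
end

section
/- Let (Ch,≽) be a market with contracts in which students have strict preferences monotone in contract terms and contracts are observable substitutes for monotone preferences under every college's choice function. Then the outcome DA(Ch,≽) of the student-proposing deferred acceptance algorithm is a stable allocation in (Ch,≽). -/
open scoped Classical

namespace MWC

variable {C S T : Type*} [DecidableEq C] [DecidableEq S] [DecidableEq T] [LinearOrder T]

/-! Contracts are triples `(college, student, term)`.  For `x : C × S × T`,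
`x.1` is the college, `x.2.1` the student and `x.2.2` the contract term.
The linear order on `T` plays the role of `▷`: higher terms are better for students. -/

variable (X : Finset (C × S × T))

/-- Consequence of IRC: removing a set of rejected contracts changes nothing. -/
theorem aux_irc (X : Finset (C × S × T)) (c : C)
    (Ch : Finset (C × S × T) → Finset (C × S × T)) (h : IsChoice X c Ch)
    (B : Finset (C × S × T)) (N : Finset (C × S × T)) :
    B ∪ N ⊆ Xc X c → Ch (B ∪ N) ⊆ B → Ch B = Ch (B ∪ N) := by
  induction N using Finset.induction_on with
  | empty => intro _ _; simp
  | insert x N hx ih =>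
    intro hs hc
    rw [Finset.union_insert] at hs hc ⊢
    by_cases hxB : x ∈ B ∪ N
    · rw [Finset.insert_eq_of_mem hxB] at hs hc ⊢
      exact ih hs hc
    · have hxB' : x ∉ B := fun hh => hxB (Finset.mem_union_left _ hh)
      have e := h.2.2 (B ∪ N) (fun y hy => hs (Finset.mem_insert_of_mem hy)) x
        (hs (Finset.mem_insert_self _ _)) hxB (fun hh => hxB' (hc hh))
      rw [← e] at hc ⊢
      exact ih (fun y hy => hs (Finset.mem_insert_of_mem hy)) hc

theorem aux_irc' (X : Finset (C × S × T)) (c : C)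
    (Ch : Finset (C × S × T) → Finset (C × S × T)) (h : IsChoice X c Ch)
    (B A : Finset (C × S × T)) (hA : A ⊆ Xc X c) (hBA : B ⊆ A) (hc : Ch A ⊆ B) :
    Ch B = Ch A := by
  have e : B ∪ A = A := Finset.union_eq_right.mpr hBA
  have := aux_irc X c Ch h B A
  rw [e] at this
  exact this hA hc

/-- A list that is an observable sequence generated from monotone preferences. -/
def Good (X : Finset (C × S × T)) (c : C)
    (Ch : Finset (C × S × T) → Finset (C × S × T)) (L : List (C × S × T)) : Prop :=
  SeqIn X c L ∧ GenMono X c L ∧ ObsSeq Ch L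

theorem aux_snoc (X : Finset (C × S × T)) (c : C)
    (Ch : Finset (C × S × T) → Finset (C × S × T)) (hobs : ObsSub X c Ch)
    (L : List (C × S × T)) (hL : Good X c Ch L) (x : C × S × T) (hx : x ∈ Xc X c)
    (hm : ∀ y ∈ Xc X c, y.2.1 = x.2.1 → x.2.2 < y.2.2 → y ∈ L)
    (ho : ∀ y ∈ Ch L.toFinset, y.2.1 ≠ x.2.1) :
    Good X c Ch (L ++ [x]) ∧ Rej Ch L.toFinset ⊆ Rej Ch (L ++ [x]).toFinset := by
  have hg : Good X c Ch (L ++ [x]) := by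
    obtain ⟨h1, h2, h3⟩ := hL
    refine ⟨?_, ?_, ?_⟩
    · intro y hy
      rcases List.mem_append.mp hy with hy | hy
      · exact h1 y hy
      · rw [List.mem_singleton.mp hy]; exact hx
    · intro t ht y hy
      simp only [List.get_eq_getElem]
      by_cases htl : t < L.length
      · rw [List.getElem_append_left htl, List.take_append_of_le_length htl.le]
        exact h2 t htl y hy
      · have : t = L.length := by simp at ht; omega
        subst this
        simpa using hm y hy
    · intro t ht h0
      simp only [List.get_eq_getElem]
      by_cases htl : t < L.length
      · rw [List.getElem_append_left htl, List.take_append_of_le_length htl.le]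
        exact h3 t htl h0
      · have : t = L.length := by simp at ht; omega
        subst this
        intro hh
        obtain ⟨y, hy, hyx⟩ := Finset.mem_image.mp hh
        rw [List.take_append_of_le_length le_rfl, List.take_length] at hy
        exact ho y hy (by simpa using hyx)
  refine ⟨hg, ?_⟩
  have := hobs (L ++ [x]) hg.1 hg.2.1 hg.2.2 L.length (by simp)
  rwa [List.take_append_of_le_length le_rfl, List.take_length,
    List.take_of_length_le (by simp)] at this

theorem aux_extend (X : Finset (C × S × T)) (c : C)
    (Ch : Finset (C × S × T) → Finset (C × S × T)) (hCh : IsChoice X c Ch)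
    (hobs : ObsSub X c Ch) (N : Finset (C × S × T)) :
    ∀ (L : List (C × S × T)), Good X c Ch L → N ⊆ Xc X c → IsAlloc N →
    (∀ x ∈ N, ∀ y ∈ Xc X c, y.2.1 = x.2.1 → x.2.2 < y.2.2 → y ∈ L) →
    (∀ x ∈ N, ∀ y ∈ Ch L.toFinset, y.2.1 ≠ x.2.1) →
    ∃ L', Good X c Ch L' ∧ L'.toFinset = L.toFinset ∪ N ∧
      Rej Ch L.toFinset ⊆ Rej Ch L'.toFinset := by
  induction N using Finset.induction_on with
  | empty => intro L hL _ _ _ _; exact ⟨L, hL, by simp, fun _ h => h⟩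
  | insert x N hx ih =>
    intro L hL hN hal hm ho
    obtain ⟨hg, hr⟩ := aux_snoc X c Ch hobs L hL x (hN (Finset.mem_insert_self _ _))
      (hm x (Finset.mem_insert_self _ _)) (ho x (Finset.mem_insert_self _ _))
    obtain ⟨L', h1, h2, h3⟩ := ih (L ++ [x]) hg
      (fun y hy => hN (Finset.mem_insert_of_mem hy))
      (fun y hy z hz => hal y (Finset.mem_insert_of_mem hy) z (Finset.mem_insert_of_mem hz))
      (fun y hy z hz h h' => List.mem_append_left _
        (hm y (Finset.mem_insert_of_mem hy) z hz h h'))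
      (by
        intro y hy z hz hzy
        have hsub : (L ++ [x]).toFinset ⊆ Xc X c := fun w hw => hg.1 w (List.mem_toFinset.mp hw)
        have hzL := hCh.1 _ hsub hz
        rcases List.mem_append.mp (List.mem_toFinset.mp hzL) with hzl | hzx
        · have : z ∈ Ch L.toFinset := by
            by_contra hcon
            have : z ∈ Rej Ch L.toFinset :=
              Finset.mem_sdiff.mpr ⟨List.mem_toFinset.mpr hzl, hcon⟩
            exact (Finset.mem_sdiff.mp (hr this)).2 hz
          exact ho y (Finset.mem_insert_of_mem hy) z this hzy
        · rw [List.mem_singleton.mp hzx] at hzy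
          have := hal x (Finset.mem_insert_self _ _) y (Finset.mem_insert_of_mem hy) hzy
          exact hx (this ▸ hy))
    refine ⟨L', h1, ?_, hr.trans h3⟩
    rw [h2]
    ext y
    simp only [Finset.mem_union, List.mem_toFinset, List.mem_append, List.mem_singleton,
      Finset.mem_insert]
    tauto

theorem mem_prop (X : Finset (C × S × T)) (u : S → C × S × T → ℤ) (D : Finset (C × S × T))
    (x : C × S × T) : x ∈ proposals X u D ↔ (x ∈ X ∧ x ∉ D) ∧ 0 < u x.2.1 x ∧
      ∀ y, y ∈ X → y ∉ D → y.2.1 = x.2.1 → u x.2.1 y ≤ u x.2.1 x := by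
  unfold proposals
  simp only [Finset.mem_filter, Finset.mem_sdiff, and_imp]

theorem prop_alloc (X : Finset (C × S × T)) (u : S → C × S × T → ℤ)
    (hu : ∀ s, IsPref X s (u s)) (D : Finset (C × S × T)) : IsAlloc (proposals X u D) := by
  intro x hx y hy hxy
  rw [mem_prop] at hx hy
  by_contra hne
  refine (hu x.2.1).2.1 x hx.1.1 y hy.1.1 rfl hxy.symm hne ?_
  have h1 := hx.2.2 y hy.1.1 hy.1.2 hxy.symm
  have h2 := hy.2.2 x hx.1.1 hx.1.2 hxy
  rw [← hxy] at h2
  omega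

theorem mem_held (Ch : C → Finset (C × S × T) → Finset (C × S × T))
    (P : Finset (C × S × T)) (x : C × S × T) :
    x ∈ held Ch P ↔ x ∈ P ∧ x ∈ Ch x.1 (P.filter fun y => y.1 = x.1) := by
  unfold held
  simp only [Finset.mem_filter]

/-- The invariant of deferred acceptance. -/
def Inv (X : Finset (C × S × T)) (Ch : C → Finset (C × S × T) → Finset (C × S × T))
    (u : S → C × S × T → ℤ) (D : Finset (C × S × T)) : Prop :=
  D ⊆ X ∧ ∀ c, (∃ L, Good X c (Ch c) L ∧
    L.toFinset = (D ∪ proposals X u D).filter (fun x => x.1 = c)) ∧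
    ∀ x ∈ Ch c ((D ∪ proposals X u D).filter (fun x => x.1 = c)), x ∉ D

theorem filt_sub (X : Finset (C × S × T)) (u : S → C × S × T → ℤ) (D : Finset (C × S × T))
    (hD : D ⊆ X) (c : C) :
    (D ∪ proposals X u D).filter (fun x => x.1 = c) ⊆ Xc X c := by
  intro x hx
  obtain ⟨hx, hc⟩ := Finset.mem_filter.mp hx
  refine Finset.mem_filter.mpr ⟨?_, hc⟩
  rcases Finset.mem_union.mp hx with h | h
  · exact hD h
  · exact ((mem_prop X u D x).mp h).1.1

theorem inv_ch (X : Finset (C × S × T)) (Ch : C → Finset (C × S × T) → Finset (C × S × T))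
    (u : S → C × S × T → ℤ) (hCh : ∀ c, IsChoice X c (Ch c))
    (D : Finset (C × S × T)) (hI : Inv X Ch u D) (c : C) :
    Ch c ((proposals X u D).filter (fun x => x.1 = c)) =
    Ch c ((D ∪ proposals X u D).filter (fun x => x.1 = c)) := by
  have hs := filt_sub X u D hI.1 c
  refine aux_irc' X c (Ch c) (hCh c) _ _ hs ?_ ?_
  · exact Finset.filter_subset_filter _ Finset.subset_union_right
  · intro x hx
    have h1 := (hI.2 c).2 x hx
    obtain ⟨h2, h3⟩ := Finset.mem_filter.mp ((hCh c).1 _ hs hx)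
    exact Finset.mem_filter.mpr ⟨(Finset.mem_union.mp h2).resolve_left h1, h3⟩

theorem inv_zero (X : Finset (C × S × T)) (Ch : C → Finset (C × S × T) → Finset (C × S × T))
    (u : S → C × S × T → ℤ) (hCh : ∀ c, IsChoice X c (Ch c))
    (hobs : ∀ c, ObsSub X c (Ch c)) (hu : ∀ s, IsPref X s (u s)) : Inv X Ch u ∅ := by
  refine ⟨by simp, fun c => ⟨?_, by simp⟩⟩
  have hnil : Good X c (Ch c) [] := by
    refine ⟨?_, ?_, ?_⟩
    · intro x hx; simp at hx
    · intro t ht; simp at ht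
    · intro t ht; simp at ht
  obtain ⟨L, h1, h2, _⟩ := aux_extend X c (Ch c) (hCh c) (hobs c)
    ((∅ ∪ proposals X u ∅).filter (fun x => x.1 = c)) [] hnil
    (filt_sub X u ∅ (by simp) c)
    (by
      intro x hx y hy
      simp only [Finset.empty_union, Finset.mem_filter] at hx hy
      exact prop_alloc X u hu ∅ x hx.1 y hy.1)
    (by
      intro x hx y hy hyx hlt
      simp only [Finset.empty_union, Finset.mem_filter, mem_prop, Xc] at hx hy
      have h1 := hx.1.2.2 y hy.1 (by simp) hyx
      have h2 := (hu x.2.1).2.2 y hy.1 x hx.1.1.1 hyx rfl hlt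
      omega)
    (by
      intro x hx y hy
      have := (hCh c).1 ([] : List (C × S × T)).toFinset (by simp) hy
      simp at this)
  exact ⟨L, h1, by simpa using h2⟩

theorem inv_step (X : Finset (C × S × T)) (Ch : C → Finset (C × S × T) → Finset (C × S × T))
    (u : S → C × S × T → ℤ) (hCh : ∀ c, IsChoice X c (Ch c))
    (hobs : ∀ c, ObsSub X c (Ch c)) (hu : ∀ s, IsPref X s (u s))
    (D : Finset (C × S × T)) (hI : Inv X Ch u D) : Inv X Ch u (step X Ch u D) := by
  have hDs : ∀ x, x ∈ step X Ch u D ↔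
      x ∈ D ∨ (x ∈ proposals X u D ∧ x ∉ held Ch (proposals X u D)) := by
    intro x; unfold step; simp only [Finset.mem_union, Finset.mem_sdiff]
  -- held contracts, seen through the cumulative choice
  have hheld : ∀ x, x ∈ held Ch (proposals X u D) ↔
      x ∈ Ch x.1 ((D ∪ proposals X u D).filter (fun y => y.1 = x.1)) := by
    intro x
    rw [mem_held, inv_ch X Ch u hCh D hI]
    refine ⟨fun h => h.2, fun h => ⟨?_, h⟩⟩
    have h1 := (hI.2 x.1).2 x h
    have h2 := Finset.mem_filter.mp ((hCh x.1).1 _ (filt_sub X u D hI.1 x.1) h)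
    exact (Finset.mem_union.mp h2.1).resolve_left h1
  have hDX : step X Ch u D ⊆ X := by
    intro x hx
    rcases (hDs x).mp hx with h | h
    · exact hI.1 h
    · exact ((mem_prop X u D x).mp h.1).1.1
  have hstay : ∀ x ∈ held Ch (proposals X u D), x ∈ proposals X u (step X Ch u D) := by
    intro x hx
    have hp := ((mem_held Ch _ x).mp hx).1
    have hp' := (mem_prop X u D x).mp hp
    rw [mem_prop]
    refine ⟨⟨hp'.1.1, ?_⟩, hp'.2.1, ?_⟩
    · intro h
      rcases (hDs x).mp h with h | h
      · exact hp'.1.2 h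
      · exact h.2 hx
    · intro y hy hyD hyx
      exact hp'.2.2 y hy (fun h => hyD ((hDs y).mpr (Or.inl h))) hyx
  refine ⟨hDX, fun c => ?_⟩
  obtain ⟨⟨L, hL, hLf⟩, hdis⟩ := hI.2 c
  have hLmem : ∀ x, x ∈ L ↔ (x ∈ D ∨ x ∈ proposals X u D) ∧ x.1 = c := by
    intro x
    rw [← List.mem_toFinset, hLf, Finset.mem_filter, Finset.mem_union]
  have hDL : ∀ x, x ∈ step X Ch u D → x.1 = c → x ∈ L := by
    intro x hx hc
    rw [hLmem]
    rcases (hDs x).mp hx with h | h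
    · exact ⟨Or.inl h, hc⟩
    · exact ⟨Or.inr h.1, hc⟩
  obtain ⟨L', h1, h2, h3⟩ := aux_extend X c (Ch c) (hCh c) (hobs c)
    ((proposals X u (step X Ch u D) \ held Ch (proposals X u D)).filter (fun x => x.1 = c))
    L hL
    (by
      intro x hx
      obtain ⟨hx, hc⟩ := Finset.mem_filter.mp hx
      exact Finset.mem_filter.mpr
        ⟨((mem_prop X u _ x).mp (Finset.mem_sdiff.mp hx).1).1.1, hc⟩)
    (by
      intro x hx y hy
      simp only [Finset.mem_filter, Finset.mem_sdiff] at hx hy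
      exact prop_alloc X u hu _ x hx.1.1 y hy.1.1)
    (by
      intro x hx y hy hyx hlt
      simp only [Finset.mem_filter, Finset.mem_sdiff, mem_prop, Xc] at hx hy
      refine hDL y ?_ hy.2
      by_contra hyD
      have h1 := hx.1.1.2.2 y hy.1 hyD hyx
      have h2 := (hu x.2.1).2.2 y hy.1 x hx.1.1.1.1 hyx rfl hlt
      omega)
    (by
      intro x hx y hy hyx
      simp only [Finset.mem_filter, Finset.mem_sdiff] at hx
      rw [hLf] at hy
      have hyc := (Finset.mem_filter.mp ((hCh c).1 _ (filt_sub X u D hI.1 c) hy)).2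
      have hyh : y ∈ held Ch (proposals X u D) := by
        rw [hheld, hyc]; exact hy
      have := prop_alloc X u hu _ y (hstay y hyh) x hx.1.1 hyx
      exact hx.1.2 (this ▸ hyh))
  have hL'f : L'.toFinset =
      (step X Ch u D ∪ proposals X u (step X Ch u D)).filter (fun x => x.1 = c) := by
    rw [h2]
    ext x
    simp only [Finset.mem_union, List.mem_toFinset, hLmem, Finset.mem_filter,
      Finset.mem_sdiff, hDs]
    have a1 := hstay x
    have a2 := fun h => ((mem_held Ch (proposals X u D) x).mp h).1
    tauto
  refine ⟨⟨L', h1, hL'f⟩, ?_⟩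
  intro x hx hxD
  rw [← hL'f] at hx
  have hsub : L'.toFinset ⊆ Xc X c := fun w hw => h1.1 w (List.mem_toFinset.mp hw)
  have hxc : x.1 = c := (Finset.mem_filter.mp (hsub ((hCh c).1 _ hsub hx))).2
  have hrej : x ∈ Rej (Ch c) L.toFinset := by
    refine Finset.mem_sdiff.mpr ⟨List.mem_toFinset.mpr (hDL x hxD hxc), ?_⟩
    rw [hLf]
    intro hcx
    rcases (hDs x).mp hxD with h | h
    · exact hdis x hcx h
    · apply h.2
      rw [hheld, hxc]; exact hcx
  exact (Finset.mem_sdiff.mp (h3 hrej)).2 hx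

theorem step_fixed (X : Finset (C × S × T)) (Ch : C → Finset (C × S × T) → Finset (C × S × T))
    (u : S → C × S × T → ℤ) (r : ℕ) :
    step X Ch u ((step X Ch u)^[r] ∅) = (step X Ch u)^[r] ∅ ∨
      r ≤ ((step X Ch u)^[r] ∅).card := by
  induction r with
  | zero => right; simp
  | succ r ih =>
    rw [Function.iterate_succ_apply']
    by_cases hf : step X Ch u ((step X Ch u)^[r] ∅) = (step X Ch u)^[r] ∅
    · left; rw [hf, hf]
    · right
      have h1 := ih.resolve_left hf
      have h2 : (step X Ch u)^[r] ∅ ⊂ step X Ch u ((step X Ch u)^[r] ∅) :=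
        (Finset.ssubset_iff_subset_ne).mpr
          ⟨Finset.subset_union_left, fun h => hf h.symm⟩
      have := Finset.card_lt_card h2
      omega

theorem fixed_stable (X : Finset (C × S × T))
    (Ch : C → Finset (C × S × T) → Finset (C × S × T))
    (u : S → C × S × T → ℤ) (hCh : ∀ c, IsChoice X c (Ch c))
    (hu : ∀ s, IsPref X s (u s))
    (D : Finset (C × S × T)) (hI : Inv X Ch u D) (hf : step X Ch u D = D) :
    Stable X Ch u (held Ch (proposals X u D)) := by
  have hPh : held Ch (proposals X u D) = proposals X u D := by
    refine Finset.Subset.antisymm (Finset.filter_subset _ _) ?_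
    intro x hx
    by_contra hn
    have : x ∈ step X Ch u D :=
      Finset.mem_union_right _ (Finset.mem_sdiff.mpr ⟨hx, hn⟩)
    rw [hf] at this
    exact ((mem_prop X u D x).mp hx).1.2 this
  have hPX : proposals X u D ⊆ X := fun x hx => ((mem_prop X u D x).mp hx).1.1
  have hIR : ∀ c, (proposals X u D).filter (fun x => x.1 = c) =
      Ch c ((proposals X u D).filter fun x => x.1 = c) := by
    intro c
    refine Finset.Subset.antisymm ?_ ((hCh c).1 _ (Finset.filter_subset_filter _ hPX))
    intro x hx
    obtain ⟨hx, hc⟩ := Finset.mem_filter.mp hx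
    rw [← hPh, mem_held] at hx
    have := hx.2
    rwa [hc] at this
  rw [hPh]
  refine ⟨hPX, prop_alloc X u hu D, ⟨hIR, fun y hy => ((mem_prop X u D y).mp hy).2.1⟩, ?_⟩
  rintro ⟨c, Z, hZX, hZa, hne, hZc, hZu⟩
  apply hne
  have hA := filt_sub X u D hI.1 c
  have hmem : ∀ z ∈ Z, z.1 = c → z ∈ D ∨ z ∈ proposals X u D := by
    intro z hz hzc
    by_contra hcon
    push Not at hcon
    obtain ⟨hzD, hzP⟩ := hcon
    have hzu := hZu z (Finset.mem_filter.mpr ⟨hz, hzc⟩)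
    have hzX := hZX hz
    have hex : ∃ y ∈ proposals X u D, y.2.1 = z.2.1 ∨ False := by
      by_contra hno
      push Not at hno
      have h0 : util (u z.2.1) z.2.1 (proposals X u D) = 0 := by
        unfold util
        rw [Finset.filter_false_of_mem (fun y hy h => (hno y hy).1 h)]
        simp
      have hz0 := (hu z.2.1).1 z hzX rfl
      obtain ⟨m, hm, hmax⟩ := Finset.exists_max_image
        ((X \ D).filter fun x => x.2.1 = z.2.1) (u z.2.1)
        ⟨z, by simp [hzX, hzD]⟩
      simp only [Finset.mem_filter, Finset.mem_sdiff] at hm hmax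
      have hmz := hmax z ⟨⟨hzX, hzD⟩, rfl⟩
      refine (hno m ?_).1 hm.2
      rw [mem_prop, hm.2]
      exact ⟨hm.1, by omega, fun y h1 h2 h3 => hmax y ⟨⟨h1, h2⟩, h3⟩⟩
    obtain ⟨y, hy, hyz⟩ := hex
    have hyz : y.2.1 = z.2.1 := by simpa using hyz
    have hut : util (u z.2.1) z.2.1 (proposals X u D) = u z.2.1 y := by
      unfold util
      rw [show (proposals X u D).filter (fun x => x.2.1 = z.2.1) = {y} from ?_]
      · simp
      · ext w
        rw [Finset.mem_filter, Finset.mem_singleton]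
        constructor
        · rintro ⟨hw, hwz⟩
          exact prop_alloc X u hu D w hw y hy (hwz.trans hyz.symm)
        · rintro rfl; exact ⟨hy, hyz⟩
    have hyp := (mem_prop X u D y).mp hy
    have h1 := hyp.2.2 z hzX hzD hyz.symm
    rw [hyz] at h1
    have hyne : y ≠ z := fun h => hzP (h ▸ hy)
    exact (hu z.2.1).2.1 y hyp.1.1 z hzX hyz rfl hyne (by omega)
  have hCA : Ch c ((D ∪ proposals X u D).filter (fun x => x.1 = c)) =
      (proposals X u D).filter (fun x => x.1 = c) := by
    rw [← inv_ch X Ch u hCh D hI c]; exact (hIR c).symm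
  rw [hZc, ← hCA]
  refine aux_irc' X c (Ch c) (hCh c) _ _ hA ?_ ?_
  · intro x hx
    obtain ⟨hx, hxc⟩ := Finset.mem_filter.mp hx
    refine Finset.mem_filter.mpr ⟨?_, hxc⟩
    rw [Finset.mem_union] at hx ⊢
    rcases hx with h | h
    · exact Or.inr h
    · exact hmem x h hxc
  · rw [hCA]
    exact Finset.filter_subset_filter _ Finset.subset_union_left

/-- under observable substitutability the DA outcome is stable. -/
theorem statement_8 [Fintype C] [Fintype S] [Fintype T]
    (X : Finset (C × S × T)) (Ch : C → Finset (C × S × T) → Finset (C × S × T))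
    (u : S → C × S × T → ℤ)
    (hCh : ∀ c, IsChoice X c (Ch c))
    (hobs : ∀ c, ObsSub X c (Ch c))
    (hu : ∀ s, IsPref X s (u s)) :
    Stable X Ch u (DA X Ch u) := by
  have hI : ∀ r, Inv X Ch u ((step X Ch u)^[r] ∅) := by
    intro r
    induction r with
    | zero => exact inv_zero X Ch u hCh hobs hu
    | succ r ih =>
      rw [Function.iterate_succ_apply']
      exact inv_step X Ch u hCh hobs hu _ ih
  have hI' := hI (X.card + 1)
  refine fixed_stable X Ch u hCh hu _ hI' ?_
  refine (step_fixed X Ch u (X.card + 1)).resolve_right ?_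
  have := Finset.card_le_card hI'.1
  omega
end MWC
end

section
/- Suppose contracts are observable substitutes for monotone preferences under Ch_c and Ch_c satisfies the observable law of aggregate demand for monotone preferences. Then the virtual choice function Ch'_c(Y) := { x ∈ Y^min : x_S ∈ [Ch_c(Y^∨)]_S } is a well-defined choice function selecting at most one contract per student, contracts are substitutes under Ch'_c, Ch'_c satisfies the law of aggregate demand, and Ch'_c is monotone in contract terms. -/
open scoped Classical

namespace MWC

variable {C S T : Type*} [DecidableEq C] [DecidableEq S] [DecidableEq T] [LinearOrder T]

/-! Contracts are triples `(college, student, term)`.  For `x : C × S × T`,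
`x.1` is the college, `x.2.1` the student and `x.2.2` the contract term.
The linear order on `T` plays the role of `▷`: higher terms are better for students. -/

variable (X : Finset (C × S × T))

section Helpers

lemma genMono_append (c : C) (L : List (C × S × T)) (x : C × S × T) :
    GenMono X c (L ++ [x]) ↔
      GenMono X c L ∧ ∀ y ∈ Xc X c, y.2.1 = x.2.1 → x.2.2 < y.2.2 → y ∈ L := by
  constructor
  · intro h
    refine ⟨fun t ht y hy h1 h2 => ?_, fun y hy h1 h2 => ?_⟩
    · have := h t (by simp; omega) y hy
      simp only [List.get_eq_getElem, List.getElem_append_left ht] at this h1 h2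
      have := this h1 h2
      rwa [List.take_append_of_le_length ht.le] at this
    · have := h L.length (by simp) y hy
      simp only [List.get_eq_getElem, List.getElem_concat_length] at this
      simpa using this h1 h2
  · rintro ⟨h, hx⟩ t ht y hy h1 h2
    by_cases htl : t < L.length
    · simp only [List.get_eq_getElem, List.getElem_append_left htl] at h1 h2
      rw [List.take_append_of_le_length htl.le]
      exact h t htl y hy h1 h2
    · have : t = L.length := by simp at ht; omega
      subst this
      simp only [List.get_eq_getElem, List.getElem_concat_length] at h1 h2
      simpa using hx y hy h1 h2

lemma obsSeq_append (Ch : Finset (C × S × T) → Finset (C × S × T))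
    (L : List (C × S × T)) (x : C × S × T) :
    ObsSeq Ch (L ++ [x]) ↔
      ObsSeq Ch L ∧ (L ≠ [] → x.2.1 ∉ (Ch L.toFinset).image fun y => y.2.1) := by
  constructor
  · intro h
    refine ⟨fun t ht h0 => ?_, fun hL => ?_⟩
    · have := h t (by simp; omega) h0
      rw [List.take_append_of_le_length ht.le] at this
      simpa only [List.get_eq_getElem, List.getElem_append_left ht] using this
    · have := h L.length (by simp) (List.length_pos_iff.2 hL)
      simp only [List.get_eq_getElem, List.getElem_concat_length, List.take_left] at this
      exact this
  · rintro ⟨h, hx⟩ t ht h0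
    by_cases htl : t < L.length
    · rw [List.take_append_of_le_length htl.le]
      simpa only [List.get_eq_getElem, List.getElem_append_left htl] using h t htl h0
    · have : t = L.length := by simp at ht; omega
      subst this
      simp only [List.get_eq_getElem, List.getElem_concat_length, List.take_left]
      exact hx (List.length_pos_iff.1 h0)

/-- One observable extension of an observable set by a contract of `U`. -/
def OStep (c : C) (Ch : Finset (C × S × T) → Finset (C × S × T)) (U : Finset (C × S × T))
    (A B : Finset (C × S × T)) : Prop :=
  ObsSet X c Ch A ∧ ∃ x ∈ U, x ∈ Xc X c ∧ x ∉ A ∧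
    (∀ y ∈ Xc X c, y.2.1 = x.2.1 → x.2.2 < y.2.2 → y ∈ A) ∧
    (∀ y ∈ Ch A, y.2.1 ≠ x.2.1) ∧ B = insert x A

variable {X}

lemma ostep_main {c : C} {Ch : Finset (C × S × T) → Finset (C × S × T)}
    {U A B : Finset (C × S × T)} (h : OStep X c Ch U A B) :
    ∃ L : List (C × S × T), ∃ x, L.toFinset = A ∧ (L ++ [x]).toFinset = B ∧
      (L ++ [x]).Nodup ∧ SeqIn X c (L ++ [x]) ∧ GenMono X c (L ++ [x]) ∧ ObsSeq Ch (L ++ [x]) := by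
  obtain ⟨⟨L, hnd, rfl, hin, hg, ho⟩, x, hxU, hxX, hxA, hb, hc, rfl⟩ := h
  refine ⟨L, x, rfl, ?_, ?_, ?_, ?_, ?_⟩
  · ext y; simp [or_comm]
  · rw [List.nodup_append_comm]; simpa [hnd] using hxA
  · intro y hy
    rcases List.mem_append.1 hy with hy | hy
    · exact hin y hy
    · simp at hy; exact hy ▸ hxX
  · rw [genMono_append]
    exact ⟨hg, fun y hy h1 h2 => by simpa using hb y hy h1 h2⟩
  · rw [obsSeq_append]
    refine ⟨ho, fun _ hm => ?_⟩
    obtain ⟨y, hy, he⟩ := Finset.mem_image.1 hm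
    exact hc y hy he

lemma ostep_obs {c : C} {Ch : Finset (C × S × T) → Finset (C × S × T)}
    {U A B : Finset (C × S × T)} (h : OStep X c Ch U A B) : ObsSet X c Ch B := by
  obtain ⟨L, x, -, h1, h2, h3, h4, h5⟩ := ostep_main h
  exact ⟨_, h2, h1, h3, h4, h5⟩

lemma ostep_rej {c : C} {Ch : Finset (C × S × T) → Finset (C × S × T)} (hobs : ObsSub X c Ch)
    {U A B : Finset (C × S × T)} (h : OStep X c Ch U A B) : Rej Ch A ⊆ Rej Ch B := by
  obtain ⟨L, x, h0, h1, h2, h3, h4, h5⟩ := ostep_main h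
  have := hobs _ h3 h4 h5 L.length (by simp)
  rw [List.take_left, List.take_of_length_le (by simp)] at this
  rwa [h0, h1] at this

lemma ostep_card {c : C} {Ch : Finset (C × S × T) → Finset (C × S × T)} (hlad : ObsLAD X c Ch)
    {U A B : Finset (C × S × T)} (h : OStep X c Ch U A B) : (Ch A).card ≤ (Ch B).card := by
  obtain ⟨L, x, h0, h1, h2, h3, h4, h5⟩ := ostep_main h
  have := hlad _ h3 h4 h5 L.length (by simp)
  rw [List.take_left, List.take_of_length_le (by simp)] at this
  rwa [h0, h1] at this

lemma obsSet_empty (c : C) (Ch : Finset (C × S × T) → Finset (C × S × T)) :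
    ObsSet X c Ch ∅ :=
  ⟨[], List.nodup_nil, rfl, by simp [SeqIn], by intro t ht; simp at ht,
    by intro t ht; simp at ht⟩

lemma reach_of_obs {c : C} {Ch : Finset (C × S × T) → Finset (C × S × T)}
    (hCh : IsChoice X c Ch) {U : Finset (C × S × T)} (L : List (C × S × T)) :
    L.Nodup → SeqIn X c L → GenMono X c L → ObsSeq Ch L → L.toFinset ⊆ U →
      Relation.ReflTransGen (OStep X c Ch U) ∅ L.toFinset := by
  induction L using List.reverseRecOn with
  | nil => intros; exact Relation.ReflTransGen.refl
  | append_singleton L x ih =>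
    intro hnd hin hg ho hU
    rw [genMono_append] at hg
    rw [obsSeq_append] at ho
    have hnd' := hnd
    rw [List.nodup_append_comm] at hnd'
    simp at hnd'
    have hin' : SeqIn X c L := fun y hy => hin y (List.mem_append_left _ hy)
    have hU' : L.toFinset ⊆ U := fun y hy => hU (by simp at hy ⊢; exact Or.inr hy)
    refine (ih hnd'.2 hin' hg.1 ho.1 hU').tail ?_
    refine ⟨⟨L, hnd'.2, rfl, hin', hg.1, ho.1⟩, x, hU (by simp), hin x (by simp), by simpa using hnd'.1,
      fun y hy h1 h2 => by simpa using hg.2 y hy h1 h2, fun y hy he => ?_, ?_⟩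
    · have hL : L ≠ [] := by
        rintro rfl
        have := hCh.1 ∅ (by simp) hy
        simp at this
      exact ho.2 hL (Finset.mem_image.2 ⟨y, hy, he⟩)
    · ext y; simp [or_comm]

lemma eq_of_same {c : C} {x y : C × S × T} (hx : x ∈ Xc X c) (hy : y ∈ Xc X c)
    (h1 : x.2.1 = y.2.1) (h2 : x.2.2 = y.2.2) : x = y := by
  simp only [Xc, Finset.mem_filter] at hx hy
  exact Prod.ext (hx.2.trans hy.2.symm) (Prod.ext h1 h2)

lemma obs_sub_Xc {c : C} {Ch : Finset (C × S × T) → Finset (C × S × T)}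
    {A : Finset (C × S × T)} (h : ObsSet X c Ch A) : A ⊆ Xc X c := by
  obtain ⟨L, -, rfl, hin, -⟩ := h
  intro y hy
  exact hin y (by simpa using hy)

lemma ostep_half {c : C} {Ch : Finset (C × S × T) → Finset (C × S × T)}
    (hCh : IsChoice X c Ch) (hobs : ObsSub X c Ch) {U A : Finset (C × S × T)}
    {a b : C × S × T} (hab : a ≠ b) (ha : OStep X c Ch U A (insert a A))
    (haX : a ∈ Xc X c) (haA : a ∉ A)
    (hbA : ∀ y ∈ Xc X c, y.2.1 = a.2.1 → a.2.2 < y.2.2 → y ∈ A)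
    (hbU : b ∈ U) (hbX : b ∈ Xc X c) (hb1 : b ∉ A)
    (hb2 : ∀ y ∈ Xc X c, y.2.1 = b.2.1 → b.2.2 < y.2.2 → y ∈ A)
    (hb3 : ∀ y ∈ Ch A, y.2.1 ≠ b.2.1) :
    OStep X c Ch U (insert a A) (insert b (insert a A)) := by
  refine ⟨ostep_obs ha, b, hbU, hbX, by simp [hab.symm, hb1],
    fun y hy h1 h2 => Finset.mem_insert_of_mem (hb2 y hy h1 h2), fun y hy he => ?_, rfl⟩
  have hy' := hCh.1 _ (obs_sub_Xc (ostep_obs ha)) hy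
  rcases Finset.mem_insert.1 hy' with rfl | hyA
  · rcases lt_trichotomy y.2.2 b.2.2 with h | h | h
    · exact hb1 (hbA b hbX he.symm h)
    · exact hab (eq_of_same haX hbX he h)
    · exact haA (hb2 y haX he h)
  · have h1 : y ∈ Rej Ch A := Finset.mem_sdiff.2 ⟨hyA, fun h => hb3 y h he⟩
    exact (Finset.mem_sdiff.1 (ostep_rej hobs ha h1)).2 hy

lemma ostep_diamond {c : C} {Ch : Finset (C × S × T) → Finset (C × S × T)}
    (hCh : IsChoice X c Ch) (hobs : ObsSub X c Ch) {U : Finset (C × S × T)}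
    (A B D : Finset (C × S × T)) (h1 : OStep X c Ch U A B) (h2 : OStep X c Ch U A D) :
    ∃ E, Relation.ReflGen (OStep X c Ch U) B E ∧ Relation.ReflTransGen (OStep X c Ch U) D E := by
  have h1' := h1
  have h2' := h2
  obtain ⟨_, a, a1, a2, a3, a4, a5, rfl⟩ := h1
  obtain ⟨_, b, b1, b2, b3, b4, b5, rfl⟩ := h2
  by_cases hab : a = b
  · subst hab
    exact ⟨_, Relation.ReflGen.refl, Relation.ReflTransGen.refl⟩
  · refine ⟨insert b (insert a A), Relation.ReflGen.single
      (ostep_half hCh hobs hab h1' a2 a3 a4 b1 b2 b3 b4 b5), Relation.ReflTransGen.single ?_⟩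
    rw [Finset.insert_comm]
    exact ostep_half hCh hobs (Ne.symm hab) h2' b2 b3 b4 a1 a2 a3 a4 a5

lemma reach_sub {c : C} {Ch : Finset (C × S × T) → Finset (C × S × T)}
    {U A B : Finset (C × S × T)} (h : Relation.ReflTransGen (OStep X c Ch U) A B)
    (hA : ObsSet X c Ch A) (hU : A ⊆ U) : ObsSet X c Ch B ∧ A ⊆ B ∧ B ⊆ U := by
  induction h with
  | refl => exact ⟨hA, Finset.Subset.refl _, hU⟩
  | tail _ hs ih =>
    refine ⟨ostep_obs hs, ?_⟩
    obtain ⟨_, b, b1, b2, b3, b4, b5, rfl⟩ := hs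
    exact ⟨ih.2.1.trans (Finset.subset_insert _ _), Finset.insert_subset b1 ih.2.2⟩

lemma reach_max {c : C} {Ch : Finset (C × S × T) → Finset (C × S × T)}
    (hCh : IsChoice X c Ch) (hobs : ObsSub X c Ch) {U A V : Finset (C × S × T)}
    (hA : ObsSet X c Ch A) (hU : A ⊆ U) (hV : MaxObsSubset X c Ch U V) :
    Relation.ReflTransGen (OStep X c Ch U) A V := by
  have key : ∀ B, ObsSet X c Ch B → B ⊆ U → Relation.ReflTransGen (OStep X c Ch U) ∅ B := by
    rintro B ⟨L, h1, rfl, h2, h3, h4⟩ hB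
    exact reach_of_obs hCh L h1 h2 h3 h4 hB
  obtain ⟨D, hAD, hVD⟩ := Relation.church_rosser (ostep_diamond hCh hobs) (key A hA hU)
    (key V hV.2.1 hV.1)
  have h := reach_sub hVD hV.2.1 hV.1
  have := hV.2.2 D h.1 h.2.1 h.2.2
  rwa [this] at hAD

lemma reach_rej {c : C} {Ch : Finset (C × S × T) → Finset (C × S × T)} (hobs : ObsSub X c Ch)
    {U A B : Finset (C × S × T)} (h : Relation.ReflTransGen (OStep X c Ch U) A B) :
    Rej Ch A ⊆ Rej Ch B := by
  induction h with
  | refl => exact Finset.Subset.refl _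
  | tail _ hs ih => exact ih.trans (ostep_rej hobs hs)

lemma reach_card {c : C} {Ch : Finset (C × S × T) → Finset (C × S × T)} (hlad : ObsLAD X c Ch)
    {U A B : Finset (C × S × T)} (h : Relation.ReflTransGen (OStep X c Ch U) A B) :
    (Ch A).card ≤ (Ch B).card := by
  induction h with
  | refl => exact le_rfl
  | tail _ hs ih => exact ih.trans (ostep_card hlad hs)

lemma vee_spec (c : C) (Ch : Finset (C × S × T) → Finset (C × S × T))
    (Y : Finset (C × S × T)) : MaxObsSubset X c Ch (Uset X c Y) (vee X c Ch Y) := by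
  have h : ∃ V, MaxObsSubset X c Ch (Uset X c Y) V := by
    obtain ⟨V, hV, hmax⟩ := Finset.exists_max_image
      ((Uset X c Y).powerset.filter fun V => ObsSet X c Ch V) Finset.card
      ⟨∅, by simp [obsSet_empty]⟩
    simp only [Finset.mem_filter, Finset.mem_powerset] at hV hmax
    exact ⟨V, hV.1, hV.2, fun Y' h1 h2 h3 =>
      (Finset.eq_of_subset_of_card_le h2 (hmax Y' ⟨h3, h1⟩)).symm⟩
  unfold vee
  rw [dif_pos h]
  exact h.choose_spec

lemma uset_mono (c : C) {Y Y' : Finset (C × S × T)} (h : Y ⊆ Y') :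
    Uset X c Y ⊆ Uset X c Y' := by
  intro x hx
  simp only [Uset, Finset.mem_filter] at hx ⊢
  obtain ⟨h1, y, hy, h2⟩ := hx
  exact ⟨h1, y, h hy, h2⟩

lemma vee_reach {c : C} {Ch : Finset (C × S × T) → Finset (C × S × T)}
    (hCh : IsChoice X c Ch) (hobs : ObsSub X c Ch) {Y Y' : Finset (C × S × T)} (h : Y ⊆ Y') :
    Relation.ReflTransGen (OStep X c Ch (Uset X c Y')) (vee X c Ch Y) (vee X c Ch Y') :=
  reach_max hCh hobs (vee_spec c Ch Y).2.1 ((vee_spec c Ch Y).1.trans (uset_mono c h))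
    (vee_spec c Ch Y')

lemma vee_full {c : C} {Ch : Finset (C × S × T) → Finset (C × S × T)}
    {Y : Finset (C × S × T)} {s : S}
    (hs : ∀ y ∈ Ch (vee X c Ch Y), y.2.1 ≠ s) :
    ∀ x ∈ Uset X c Y, x.2.1 = s → x ∈ vee X c Ch Y := by
  by_contra! hcon
  obtain ⟨x0, hx0, hx0s, hx0V⟩ := hcon
  obtain ⟨x, hx, hmax⟩ := Finset.exists_max_image
    ((Uset X c Y).filter fun x => x.2.1 = s ∧ x ∉ vee X c Ch Y) (fun x => x.2.2)
    ⟨x0, by simp [hx0, hx0s, hx0V]⟩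
  simp only [Finset.mem_filter] at hx hmax
  obtain ⟨hxU, hxs, hxV⟩ := hx
  have hxU' := hxU
  simp only [Uset, Finset.mem_filter] at hxU'
  obtain ⟨hxX, w, hwY, hw1, hw2⟩ := hxU'
  have hV := vee_spec (X := X) c Ch Y
  have hstep : OStep X c Ch (Uset X c Y) (vee X c Ch Y) (insert x (vee X c Ch Y)) := by
    refine ⟨hV.2.1, x, hxU, hxX, hxV, fun y hy h1 h2 => ?_, fun y hy => hxs ▸ hs y hy, rfl⟩
    by_contra hyV
    refine absurd (hmax y ⟨?_, h1.trans hxs, hyV⟩) (not_le.2 h2)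
    simp only [Uset, Finset.mem_filter]
    refine ⟨hy, w, hwY, h1.trans hw1, Or.inl ?_⟩
    rcases hw2 with h | rfl
    · exact h.trans h2
    · exact h2
  have := hV.2.2 _ (ostep_obs hstep) (Finset.subset_insert _ _) (Finset.insert_subset hxU hV.1)
  exact hxV (this ▸ Finset.mem_insert_self _ _)

lemma virtual_alloc {c : C} {Ch : Finset (C × S × T) → Finset (C × S × T)}
    {Y : Finset (C × S × T)} (hY : Y ⊆ Xc X c) : IsAlloc (virtualChoice X c Ch Y) := by
  intro x hx y hy h
  simp only [virtualChoice, Ymin, Finset.mem_filter] at hx hy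
  refine eq_of_same (hY hx.1.1) (hY hy.1.1) h (le_antisymm ?_ ?_)
  · exact not_lt.1 (hx.1.2 y hy.1.1 h.symm)
  · exact not_lt.1 (hy.1.2 x hx.1.1 h)

lemma virtual_card {c : C} {Ch : Finset (C × S × T) → Finset (C × S × T)}
    (hCh : IsChoice X c Ch) {Y : Finset (C × S × T)} (hY : Y ⊆ Xc X c) :
    (virtualChoice X c Ch Y).card = (Ch (vee X c Ch Y)).card := by
  have hV := vee_spec (X := X) c Ch Y
  have hVX := obs_sub_Xc hV.2.1
  rw [← Finset.card_image_of_injOn (f := fun y : C × S × T => y.2.1)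
      (fun x hx y hy h => virtual_alloc hY x hx y hy h),
    ← Finset.card_image_of_injOn (s := Ch (vee X c Ch Y)) (f := fun y : C × S × T => y.2.1)
      (fun x hx y hy h => hCh.2.1 _ hVX x hx y hy h)]
  congr 1
  ext s
  constructor
  · intro h
    obtain ⟨x, hx, rfl⟩ := Finset.mem_image.1 h
    exact (Finset.mem_filter.1 hx).2
  · intro h
    obtain ⟨v, hv, rfl⟩ := Finset.mem_image.1 h
    have hvU := hV.1 (hCh.1 _ hVX hv)
    simp only [Uset, Finset.mem_filter] at hvU
    obtain ⟨_, w, hwY, hw, _⟩ := hvU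
    obtain ⟨x, hx, hmin⟩ := Finset.exists_min_image
      (Y.filter fun x => x.2.1 = v.2.1) (fun x => x.2.2) ⟨w, by simp [hwY, hw]⟩
    simp only [Finset.mem_filter] at hx hmin
    refine Finset.mem_image.2 ⟨x, ?_, hx.2⟩
    simp only [virtualChoice, Ymin, Finset.mem_filter]
    exact ⟨⟨hx.1, fun y hy he => not_lt.2 (hmin y ⟨hy, he.trans hx.2⟩)⟩, hx.2 ▸ h⟩

lemma virtual_subst {c : C} {Ch : Finset (C × S × T) → Finset (C × S × T)}
    (hCh : IsChoice X c Ch) (hobs : ObsSub X c Ch) {W W' : Finset (C × S × T)}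
    (hWW : W ⊆ W') (hW' : W' ⊆ Xc X c) {x : C × S × T} (hxW : x ∈ W)
    (hx : x ∈ virtualChoice X c Ch W') : x ∈ virtualChoice X c Ch W := by
  simp only [virtualChoice, Ymin, Finset.mem_filter] at hx ⊢
  obtain ⟨⟨_, hmin⟩, hch⟩ := hx
  refine ⟨⟨hxW, fun y hy => hmin y (hWW hy)⟩, ?_⟩
  by_contra hcon
  have hs : ∀ y ∈ Ch (vee X c Ch W), y.2.1 ≠ x.2.1 := fun y hy he =>
    hcon (Finset.mem_image.2 ⟨y, hy, he⟩)
  obtain ⟨v, hv, hvx⟩ := Finset.mem_image.1 hch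
  have hV' := vee_spec (X := X) c Ch W'
  have hvU := hV'.1 (hCh.1 _ (obs_sub_Xc hV'.2.1) hv)
  simp only [Uset, Finset.mem_filter] at hvU
  obtain ⟨hvX, w, hwW, hvw, hor⟩ := hvU
  have hvx' : v.2.1 = x.2.1 := hvx
  have hle : x.2.2 ≤ w.2.2 := not_lt.1 (hmin w hwW (hvw.symm.trans hvx'))
  have hxv : x.2.2 ≤ v.2.2 := by
    rcases hor with h | rfl
    · exact hle.trans h.le
    · exact hle
  have hvUW : v ∈ Uset X c W := by
    simp only [Uset, Finset.mem_filter]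
    refine ⟨hvX, x, hxW, hvx', ?_⟩
    rcases hxv.lt_or_eq with h | h
    · exact Or.inl h
    · exact Or.inr (eq_of_same hvX (hW' (hWW hxW)) hvx' h.symm)
  have hvV := vee_full hs v hvUW hvx'
  have hr : v ∈ Rej Ch (vee X c Ch W) := Finset.mem_sdiff.2 ⟨hvV, fun h => hs v h hvx'⟩
  exact (Finset.mem_sdiff.1 (reach_rej hobs (vee_reach hCh hobs hWW) hr)).2 hv

end Helpers

/-- under observable substitutability and the observable law of
aggregate demand, the virtual choice function is a well-defined choice function
selecting at most one contract per student, under it contracts are substitutes,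
it satisfies the law of aggregate demand, and it is monotone in contract terms. -/
theorem statement_9 [Fintype C] [Fintype S] [Fintype T]
    (X : Finset (C × S × T)) (c : C)
    (Ch : Finset (C × S × T) → Finset (C × S × T))
    (hCh : IsChoice X c Ch) (hobs : ObsSub X c Ch) (hlad : ObsLAD X c Ch) :
    (∀ Y, Y ⊆ Xc X c → virtualChoice X c Ch Y ⊆ Y) ∧
    (∀ Y, Y ⊆ Xc X c → IsAlloc (virtualChoice X c Ch Y)) ∧
    Substitutes X c (virtualChoice X c Ch) ∧
    LAD X c (virtualChoice X c Ch) ∧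
    MonotoneCh X c (virtualChoice X c Ch) := by
  refine ⟨?_, fun Y hY => virtual_alloc hY, ?_, ?_, ?_⟩
  · intro Y _ x hx
    simp only [virtualChoice, Ymin, Finset.mem_filter] at hx
    exact hx.1.1
  · intro Y hY x hx z hz _ _ h
    exact virtual_subst hCh hobs (Finset.subset_insert _ _)
      (Finset.insert_subset hz (Finset.insert_subset hx hY)) (Finset.mem_insert_self _ _) h
  · intro Z Y hZY hY
    rw [virtual_card hCh hY, virtual_card hCh (hZY.trans hY)]
    exact reach_card hlad (vee_reach hCh hobs hZY)
  · intro Y _ x hx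
    exact (Finset.mem_filter.1 hx).1

end MWC
end

section
/- Suppose contracts are observable substitutes for monotone preferences under Ch_c, and let Ch'_c be the virtual choice function Ch'_c(Y) := { x ∈ Y^min : x_S ∈ [Ch_c(Y^∨)]_S }. If Y ⊆ X_c is observable under Ch_c, then Ch_c(Y) ⊆ Y^min and Ch'_c(Y) = Ch_c(Y). -/
open scoped Classical

namespace MWC

variable {C S T : Type*} [DecidableEq C] [DecidableEq S] [DecidableEq T] [LinearOrder T]

/-! Contracts are triples `(college, student, term)`.  For `x : C × S × T`,
`x.1` is the college, `x.2.1` the student and `x.2.2` the contract term.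
The linear order on `T` plays the role of `▷`: higher terms are better for students. -/

variable (X : Finset (C × S × T))

theorem mem_Ymin_iff (Y : Finset (C × S × T)) (y : C × S × T) :
    y ∈ Ymin Y ↔ y ∈ Y ∧ ∀ y' ∈ Y, y'.2.1 = y.2.1 → ¬ y'.2.2 < y.2.2 := by
  unfold Ymin
  exact Finset.mem_filter

/-- on observable sets the virtual choice function coincides with
the original choice function, and the original choice is contained in `Y^min`. -/
theorem statement_10 [Fintype C] [Fintype S] [Fintype T]
    (X : Finset (C × S × T)) (c : C)
    (Ch : Finset (C × S × T) → Finset (C × S × T))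
    (hCh : IsChoice X c Ch) (hobs : ObsSub X c Ch)
    (Y : Finset (C × S × T)) (hY : ObsSet X c Ch Y) :
    Ch Y ⊆ Ymin Y ∧ virtualChoice X c Ch Y = Ch Y := by
  obtain ⟨L, hnd, hLY, hin, hgen, hseq⟩ := hY
  have hYsub : Y ⊆ Xc X c := by
    intro x hx
    rw [← hLY, List.mem_toFinset] at hx
    exact hin x hx
  have hext : ∀ x ∈ Xc X c, ∀ y ∈ Xc X c, x.2.1 = y.2.1 → x.2.2 = y.2.2 → x = y := by
    intro x hx y hy h1 h2
    have hx1 : x.1 = c := (Finset.mem_filter.mp hx).2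
    have hy1 : y.1 = c := (Finset.mem_filter.mp hy).2
    exact Prod.ext (hx1.trans hy1.symm) (Prod.ext h1 h2)
  -- rejections are monotone along the sequence
  have hmono : ∀ k t : ℕ, t + k ≤ L.length →
      Rej Ch (L.take t).toFinset ⊆ Rej Ch (L.take (t + k)).toFinset := by
    intro k
    induction k with
    | zero => intro t _; exact subset_rfl
    | succ k ih =>
      intro t h
      exact (ih t (by omega)).trans (hobs L hin hgen hseq (t + k) (by omega))
  have hmin : Ch Y ⊆ Ymin Y := by
    intro y hy
    have hyY := hCh.1 Y hYsub hy
    refine (mem_Ymin_iff Y y).mpr ⟨hyY, ?_⟩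
    intro y' hy' hs hlt
    rw [← hLY, List.mem_toFinset] at hy'
    obtain ⟨t, ht, rfl⟩ := List.mem_iff_getElem.mp hy'
    have hyt : y ∈ L.take t := hgen t ht y (hYsub hyY) hs.symm hlt
    have hpos : 0 < t := by
      rcases Nat.eq_zero_or_pos t with h | h
      · subst h; simp at hyt
      · exact h
    have hns := hseq t ht hpos
    have hrej : y ∈ Rej Ch (L.take t).toFinset := by
      refine Finset.mem_sdiff.mpr ⟨List.mem_toFinset.mpr hyt, fun h => hns ?_⟩
      exact Finset.mem_image.mpr ⟨y, h, hs.symm⟩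
    have h2 := hmono (L.length - t) t (by omega) hrej
    rw [show t + (L.length - t) = L.length by omega, List.take_length, hLY] at h2
    exact (Finset.mem_sdiff.mp h2).2 hy
  have hU : Uset X c Y = Y := by
    ext x
    constructor
    · intro hx
      obtain ⟨hxX, y, hy, hs, h⟩ := Finset.mem_filter.mp hx
      rcases h with h | h
      · rw [← hLY, List.mem_toFinset] at hy
        obtain ⟨t, ht, rfl⟩ := List.mem_iff_getElem.mp hy
        rw [← hLY, List.mem_toFinset]
        exact List.mem_of_mem_take (hgen t ht x hxX hs h)
      · exact h ▸ hy
    · intro hx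
      exact Finset.mem_filter.mpr ⟨hYsub hx, x, hx, rfl, Or.inr rfl⟩
  have hYobs : ObsSet X c Ch Y := ⟨L, hnd, hLY, hin, hgen, hseq⟩
  have hvee : vee X c Ch Y = Y := by
    have hex : ∃ V, MaxObsSubset X c Ch (Uset X c Y) V :=
      ⟨Y, hU.symm ▸ subset_rfl, hYobs, fun Y' _ h1 h2 => (hU ▸ h2).antisymm h1⟩
    have hspec := hex.choose_spec
    unfold vee
    rw [dif_pos hex]
    exact (hspec.2.2 Y hYobs (hspec.1.trans hU.subset) hU.symm.subset).symm
  refine ⟨hmin, ?_⟩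
  unfold virtualChoice
  rw [hvee]
  ext x
  constructor
  · intro hx
    obtain ⟨hxm, hxi⟩ := Finset.mem_filter.mp hx
    obtain ⟨y, hy, hs⟩ := Finset.mem_image.mp hxi
    obtain ⟨hxY, hx2⟩ := (mem_Ymin_iff Y x).mp hxm
    obtain ⟨hyY, hy2⟩ := (mem_Ymin_iff Y y).mp (hmin hy)
    have hT : x.2.2 = y.2.2 :=
      le_antisymm (not_lt.mp (hx2 y hyY hs)) (not_lt.mp (hy2 x hxY hs.symm))
    rw [hext x (hYsub hxY) y (hYsub hyY) hs.symm hT]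
    exact hy
  · intro hx
    exact Finset.mem_filter.mpr ⟨hmin hx, Finset.mem_image.mpr ⟨x, hx, rfl⟩⟩


end MWC
end
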